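/- (Lemma 1, part (12)) For every legal ground-truth path y, every logits l, and every transition matrix A, the CRF likelihood under the masked transition matrix converges to the masked-CRF likelihood: L(l, Ā(A, c)) → L'(l, A) as c → -∞. -/

import Mathlib

open Finset Filter Topology

/-- The score of a path `p` given emission logits `l` and transition matrix `A`:
the sum of emission scores plus the sum of transition scores over consecutive pairs. -/
def score {n d : ℕ} (l : Fin (n + 1) → Fin d → ℝ) (A : Fin d → Fin d → ℝ)
    (p : Fin (n + 1) → Fin d) : ℝ :=
  (∑ i, l i (p i)) + ∑ i : Fin n, A (p i.castSucc) (p i.succ)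

/-- The masked transition matrix: entries in the illegal set `Ω` are replaced by `c`. -/
def masked {d : ℕ} (Ω : Finset (Fin d × Fin d)) (A : Fin d → Fin d → ℝ) (c : ℝ) :
    Fin d → Fin d → ℝ :=
  fun i j => if (i, j) ∈ Ω then c else A i j

/-- A path is legal if it contains no illegal transition. -/
def Legal {n d : ℕ} (Ω : Finset (Fin d × Fin d)) (p : Fin (n + 1) → Fin d) : Prop :=
  ∀ i : Fin n, (p i.castSucc, p i.succ) ∉ Ω

instance {n d : ℕ} (Ω : Finset (Fin d × Fin d)) : DecidablePred (Legal (n := n) Ω) :=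
  fun _ => by unfold Legal; infer_instance

/-- Partition function: sum of exponentiated scores over all paths. -/
noncomputable def partAll {n d : ℕ} (l : Fin (n + 1) → Fin d → ℝ)
    (A : Fin d → Fin d → ℝ) : ℝ :=
  ∑ p : Fin (n + 1) → Fin d, Real.exp (score l A p)

/-- Restricted partition function: sum of exponentiated scores over legal paths. -/
noncomputable def partLegal {n d : ℕ} (Ω : Finset (Fin d × Fin d))
    (l : Fin (n + 1) → Fin d → ℝ) (A : Fin d → Fin d → ℝ) : ℝ :=
  ∑ p ∈ Finset.univ.filter (Legal Ω), Real.exp (score l A p)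

/-- The CRF likelihood of a ground-truth path `y`. -/
noncomputable def Lik {n d : ℕ} (y : Fin (n + 1) → Fin d) (l : Fin (n + 1) → Fin d → ℝ)
    (A : Fin d → Fin d → ℝ) : ℝ :=
  Real.exp (score l A y) / partAll l A

/-- The masked-CRF likelihood of a ground-truth path `y`. -/
noncomputable def LikM {n d : ℕ} (Ω : Finset (Fin d × Fin d)) (y : Fin (n + 1) → Fin d)
    (l : Fin (n + 1) → Fin d → ℝ) (A : Fin d → Fin d → ℝ) : ℝ :=
  Real.exp (score l A y) / partLegal Ω l A

/-- The CRF loss over a family of `N` training samples. -/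
noncomputable def crfLoss {n d : ℕ} (N : ℕ) (l : Fin N → Fin (n + 1) → Fin d → ℝ)
    (y : Fin N → Fin (n + 1) → Fin d) (A : Fin d → Fin d → ℝ) : ℝ :=
  -(1 / (N : ℝ)) * ∑ k, Real.log (Lik (y k) (l k) A)

/-- The masked-CRF loss over a family of `N` training samples. -/
noncomputable def mcrfLoss {n d : ℕ} (Ω : Finset (Fin d × Fin d)) (N : ℕ)
    (l : Fin N → Fin (n + 1) → Fin d → ℝ) (y : Fin N → Fin (n + 1) → Fin d)
    (A : Fin d → Fin d → ℝ) : ℝ :=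
  -(1 / (N : ℝ)) * ∑ k, Real.log (LikM Ω (y k) (l k) A)

theorem score_masked_of_legal {n d : ℕ} {Ω : Finset (Fin d × Fin d)} {p : Fin (n + 1) → Fin d}
    (hp : Legal Ω p) (l : Fin (n + 1) → Fin d → ℝ) (A : Fin d → Fin d → ℝ) (c : ℝ) :
    score l (masked Ω A c) p = score l A p := by
  unfold score masked
  congr 1
  exact Finset.sum_congr rfl fun i _ => if_neg (hp i)

theorem tendsto_score_masked_of_not_legal {n d : ℕ} {Ω : Finset (Fin d × Fin d)}
    {p : Fin (n + 1) → Fin d} (hp : ¬ Legal Ω p) (l : Fin (n + 1) → Fin d → ℝ)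
    (A : Fin d → Fin d → ℝ) :
    Tendsto (fun c : ℝ => score l (masked Ω A c) p) atBot atBot := by
  unfold Legal at hp
  push Not at hp
  obtain ⟨i, hi⟩ := hp
  simp only [score, masked, Finset.sum_ite, Finset.sum_const, nsmul_eq_mul]
  refine tendsto_atBot_add_const_left _ _ (tendsto_atBot_add_const_right _ _ ?_)
  refine tendsto_id.const_mul_atBot ?_
  exact_mod_cast Finset.card_pos.mpr ⟨i, by simpa using hi⟩

theorem tendsto_partAll_masked {n d : ℕ} (Ω : Finset (Fin d × Fin d))
    (l : Fin (n + 1) → Fin d → ℝ) (A : Fin d → Fin d → ℝ) :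
    Tendsto (fun c : ℝ => partAll l (masked Ω A c)) atBot (𝓝 (partLegal Ω l A)) := by
  unfold partAll partLegal
  rw [Finset.sum_filter]
  refine tendsto_finsetSum _ fun p _ => ?_
  split_ifs with hp
  · simp only [score_masked_of_legal hp]
    exact tendsto_const_nhds
  · exact Real.tendsto_exp_atBot.comp (tendsto_score_masked_of_not_legal hp l A)

theorem partLegal_pos {n d : ℕ} {Ω : Finset (Fin d × Fin d)} {y : Fin (n + 1) → Fin d}
    (hy : Legal Ω y) (l : Fin (n + 1) → Fin d → ℝ) (A : Fin d → Fin d → ℝ) :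
    0 < partLegal Ω l A :=
  Finset.sum_pos (fun _ _ => Real.exp_pos _) ⟨y, by simpa using hy⟩

/-- Lemma 1, (12): for a legal ground-truth path `y`,
`L(l, Ā(A, c)) → L'(l, A)` as `c → -∞`. -/
theorem stmt_4 {n d : ℕ} (hd : 1 ≤ d) (Ω : Finset (Fin d × Fin d))
    (y : Fin (n + 1) → Fin d) (hy : Legal Ω y)
    (l : Fin (n + 1) → Fin d → ℝ) (A : Fin d → Fin d → ℝ) :
    Tendsto (fun c : ℝ => Lik y l (masked Ω A c)) atBot (𝓝 (LikM Ω y l A)) := by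
  simp only [Lik, LikM, score_masked_of_legal hy]
  exact tendsto_const_nhds.div (tendsto_partAll_masked Ω l A) (partLegal_pos hy l A).ne'
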